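/- arXiv:2004.08158 — 2 statements merged into one kernel-verified Lean document; each statement's English description precedes it below -/
import Mathlib

section
/- For all integers n ≥ m ≥ 0, there exist rational numbers q₀, q_ζ, q₄, q₅, q₆, q₇, q₈, q₉ such that Z_l(n,m) = q₀ + q_ζ·ζ(4) + Σ_{k=4}^{9} q_k·U_k(n), where ζ(4) = π⁴/90. -/
open scoped BigOperators

/-- The Pochhammer symbol `(x)_k = x (x+1) ⋯ (x+k-1)` for a real `x`. -/
noncomputable def poch (x : ℝ) (k : ℕ) : ℝ := ∏ i ∈ Finset.range k, (x + i)

/-- The rational function `R_{n,m}(t)` from the paper. -/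
noncomputable def R (n m : ℕ) (t : ℝ) : ℝ :=
  (-1 : ℝ) ^ m * (t + n / 2) * (poch (t - n) m / m.factorial) *
    (poch (t - 2 * n + m) (2 * n - m) / (2 * n - m).factorial) *
    (poch (t + n + 1) n / poch t (n + 1)) *
    (poch (t + n + 1) (2 * n - m) / poch t (2 * n - m + 1)) *
    ((n.factorial : ℝ) / poch t (n + 1)) ^ 2

/-- The rational function `R̃_{n,m}(t)` from the paper. -/
noncomputable def Rtilde (n m : ℕ) (t : ℝ) : ℝ :=
  ((n.factorial : ℝ) * poch (t - n) (2 * n - m) / (poch t (n + 1) * poch t (2 * n - m + 1))) *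
    ∑ j ∈ Finset.range (n + 1),
      (n.choose j : ℝ) ^ 2 * ((2 * n - m + j).choose n : ℝ) * poch (t - j) n / n.factorial

/-- `Z_l(n,m) = -(1/3) Σ_{ν=n-m+1}^∞ (d/dt R_{n,m}(t))|_{t=ν}`. -/
noncomputable def Zl (n m : ℕ) : ℝ :=
  -(1 / 3) * ∑' ν : ℕ, deriv (R n m) ((n : ℝ) - m + 1 + ν)

/-- `Z_r(n,m) = (1/6) Σ_{ν=1}^∞ (d²/dt² R̃_{n,m}(t))|_{t=ν}`. -/
noncomputable def Zr (n m : ℕ) : ℝ :=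
  (1 / 6) * ∑' ν : ℕ, deriv (deriv (Rtilde n m)) (1 + (ν : ℝ))

/-- `U_k(n) = Σ_{i=0}^n C(4i,2i) / ((2i+1)^k C(2i,i)^8)`. -/
noncomputable def U (k n : ℕ) : ℝ :=
  ∑ i ∈ Finset.range (n + 1),
    ((4 * i).choose (2 * i) : ℝ) / ((2 * i + 1) ^ k * ((2 * i).choose i : ℝ) ^ 8)

/-- The harmonic number `S₁(N) = Σ_{i=1}^N 1/i`. -/
noncomputable def S1 (N : ℕ) : ℝ := ∑ i ∈ Finset.range N, (1 : ℝ) / (i + 1)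

open Polynomial Filter Topology in
/-- A rational function with denominator `(∏ (t + k)) ^ 4` whose numerator has degree at least two
less than its denominator has a partial fraction expansion with vanishing sum of residues. -/
theorem exists_partialFraction (N : ℚ[X]) (n : ℕ) (hN : N.natDegree + 1 < 4 * (n + 1)) :
    ∃ c : ℕ → ℕ → ℚ, ∑ k ∈ Finset.range (n + 1), c k 0 = 0 ∧
      ∀ t : ℝ, (∀ k ∈ Finset.range (n + 1), t + k ≠ 0) →
        aeval t N / (∏ k ∈ Finset.range (n + 1), (t + k)) ^ 4 =
          ∑ k ∈ Finset.range (n + 1), ∑ j ∈ Finset.range 4, (c k j : ℝ) / (t + k) ^ (j + 1) := by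
  obtain ⟨q, r, hr, hf⟩ := eq_quo_mul_prod_pow_add_sum_rem_mul_prod_pow
    (s := Finset.range (n + 1)) N (g := fun k : ℕ => X + C (k : ℚ))
    (fun k _ => monic_X_add_C _)
    (fun i _ j _ hij => by
      have := isCoprime_X_sub_C_of_isUnit_sub (R := ℚ) (a := -(i : ℚ)) (b := -(j : ℚ))
        (IsUnit.mk0 _ (by
          intro h
          exact hij (by exact_mod_cast (by linarith : (i : ℚ) = j))))
      simpa using this)
    (fun _ => 4)
  set c : ℕ → ℕ → ℚ := fun k j => if h : 3 - j < 4 then (r k ⟨3 - j, h⟩).coeff 0 else 0 with hc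
  have hrc : ∀ k ∈ Finset.range (n + 1), ∀ j : Fin 4, r k j = C ((r k j).coeff 0) := by
    intro k hk j
    have := hr k hk j
    rw [degree_X_add_C] at this
    exact eq_C_of_degree_le_zero (Nat.WithBot.lt_one_iff_le_zero.mp this)
  have key : ∀ t : ℝ, (∀ k ∈ Finset.range (n + 1), t + k ≠ 0) →
        aeval t N / (∏ k ∈ Finset.range (n + 1), (t + k)) ^ 4 = aeval t q +
          ∑ k ∈ Finset.range (n + 1), ∑ j ∈ Finset.range 4, (c k j : ℝ) / (t + k) ^ (j + 1) := by
    intro t ht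
    have hprod : (∏ k ∈ Finset.range (n + 1), (t + k)) ≠ 0 := Finset.prod_ne_zero_iff.mpr ht
    have h2 := congrArg (aeval t) hf
    simp only [map_add, map_mul, map_sum, map_prod, map_pow, aeval_X, aeval_C] at h2
    rw [div_eq_iff (pow_ne_zero _ hprod), h2, add_mul, ← Finset.prod_pow]
    simp only [map_natCast]
    congr 1
    · rw [Finset.sum_mul]
      refine Finset.sum_congr rfl fun k hk => ?_
      rw [← Finset.mul_prod_erase _ _ hk, ← mul_assoc, ← Finset.sum_mul]
      have htk := ht k hk
      congr 1
      · rw [Fin.sum_univ_four]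
        rw [hrc k hk 0, hrc k hk 1, hrc k hk 2, hrc k hk 3]
        simp [Finset.sum_range_succ, hc]
        field_simp
        ring
  have hterm : ∀ k j : ℕ, Tendsto (fun t : ℝ => (c k j : ℝ) / (t + k) ^ (j + 1)) atTop (𝓝 0) := by
    intro k j
    exact tendsto_const_nhds.div_atTop
      ((tendsto_pow_atTop (Nat.succ_ne_zero j)).comp (tendsto_atTop_add_const_right _ _ tendsto_id))
  set D : ℝ[X] := (∏ k ∈ Finset.range (n + 1), (X + C (k : ℝ))) ^ 4 with hD
  have hDm : (∏ k ∈ Finset.range (n + 1), (X + C (k : ℝ))).Monic :=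
    monic_prod_of_monic _ _ fun k _ => monic_X_add_C _
  have hDdeg : D.natDegree = 4 * (n + 1) := by
    rw [hD, hDm.natDegree_pow, natDegree_prod_of_monic _ _ fun k _ => monic_X_add_C _]
    simp only [natDegree_X_add_C, Finset.sum_const, Finset.card_range, smul_eq_mul, mul_one]
  have hDev : ∀ t : ℝ, D.eval t = (∏ k ∈ Finset.range (n + 1), (t + k)) ^ 4 := by
    intro t
    simp [hD, eval_prod]
  have hD0 : D ≠ 0 := (hDm.pow 4).ne_zero
  have hNev : ∀ t : ℝ, aeval t N = (N.map (algebraMap ℚ ℝ)).eval t := by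
    intro t; simp [eval_map_algebraMap]
  have hlim0 : Tendsto (fun t : ℝ => aeval t N / (∏ k ∈ Finset.range (n + 1), (t + k)) ^ 4)
      atTop (𝓝 0) := by
    have := div_tendsto_atTop_zero_of_degree_lt (N.map (algebraMap ℚ ℝ)) D
      (degree_lt_degree (by rw [natDegree_map, hDdeg]; omega))
    simpa only [hNev, hDev] using this
  have hlim1 : Tendsto
      (fun t : ℝ => t * (aeval t N / (∏ k ∈ Finset.range (n + 1), (t + k)) ^ 4))
      atTop (𝓝 0) := by
    have := div_tendsto_atTop_zero_of_degree_lt (X * N.map (algebraMap ℚ ℝ)) D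
      (degree_lt_degree (by
        refine (natDegree_mul_le).trans_lt ?_
        rw [natDegree_map, hDdeg, natDegree_X]; omega))
    simpa only [hNev, hDev, eval_mul, eval_X, mul_div_assoc] using this
  have hpos : ∀ t : ℝ, 0 < t → ∀ k ∈ Finset.range (n + 1), t + k ≠ 0 := by
    intro t ht k _
    positivity
  have hq : q = 0 := by
    have h1 : Tendsto (fun t : ℝ => (q.map (algebraMap ℚ ℝ)).eval t) atTop (𝓝 0) := by
      have h2 := hlim0.sub (tendsto_finsetSum (Finset.range (n + 1)) fun k _ =>
        tendsto_finsetSum (Finset.range 4) fun j _ => hterm k j)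
      simp only [Finset.sum_const_zero, sub_zero] at h2
      refine h2.congr' ?_
      filter_upwards [eventually_gt_atTop 0] with t ht
      rw [key t (hpos t ht), eval_map_algebraMap]
      ring
    have h3 := (tendsto_nhds_iff _).mp h1
    exact (Polynomial.map_eq_zero _).mp (leadingCoeff_eq_zero.mp h3.1)
  refine ⟨c, ?_, fun t ht => by rw [key t ht, hq]; simp⟩
  have ht1 : ∀ k j : ℕ, Tendsto (fun t : ℝ => t * ((c k j : ℝ) / (t + k) ^ (j + 1))) atTop
      (𝓝 (if j = 0 then (c k 0 : ℝ) else 0)) := by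
    intro k j
    have hA : Tendsto (fun t : ℝ => t / (t + k)) atTop (𝓝 1) := by
      have hB : Tendsto (fun t : ℝ => 1 - (k : ℝ) / (t + k)) atTop (𝓝 (1 - 0)) :=
        tendsto_const_nhds.sub (tendsto_const_nhds.div_atTop
          (tendsto_atTop_add_const_right _ _ tendsto_id))
      rw [sub_zero] at hB
      refine hB.congr' ?_
      filter_upwards [eventually_gt_atTop 0] with t ht
      have : t + k ≠ 0 := by positivity
      field_simp
      ring
    have hC : Tendsto (fun t : ℝ => (c k j : ℝ) / (t + k) ^ j) atTop
        (𝓝 (if j = 0 then (c k 0 : ℝ) else 0)) := by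
      rcases j with _ | j
      · simp
      · rw [if_neg (Nat.succ_ne_zero j)]
        exact tendsto_const_nhds.div_atTop ((tendsto_pow_atTop (Nat.succ_ne_zero j)).comp
          (tendsto_atTop_add_const_right _ _ tendsto_id))
    have h := hA.mul hC
    rw [one_mul] at h
    refine h.congr fun t => ?_
    rw [pow_succ', div_mul_div_comm, mul_div_assoc]
  have h5 := tendsto_finsetSum (Finset.range (n + 1)) fun k _ =>
    tendsto_finsetSum (Finset.range 4) fun j _ => ht1 k j
  have h6 := tendsto_nhds_unique (h5.congr' (by
    filter_upwards [eventually_gt_atTop 0] with t ht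
    have := key t (hpos t ht)
    rw [hq, map_zero, zero_add] at this
    simp only [← Finset.mul_sum]
    rw [← this])) hlim1
  simp only [Finset.sum_ite_eq', Finset.mem_range, Nat.ofNat_pos, if_true] at h6
  exact_mod_cast h6

/-- An odd reflection symmetry about `-n / 2` kills the coefficient sums of even pole order. -/
theorem exists_partialFraction_of_reflect (f : ℝ → ℝ) (n : ℕ) (hf : ∀ t, f (-n - t) = -f t)
    (c : ℕ → ℕ → ℚ) (hc0 : ∑ k ∈ Finset.range (n + 1), c k 0 = 0)
    (hc : ∀ t : ℝ, (∀ k ∈ Finset.range (n + 1), t + k ≠ 0) →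
      f t = ∑ k ∈ Finset.range (n + 1), ∑ j ∈ Finset.range 4, (c k j : ℝ) / (t + k) ^ (j + 1)) :
    ∃ b : ℕ → ℕ → ℚ,
      (∀ j ∈ Finset.range 4, j ≠ 2 → ∑ k ∈ Finset.range (n + 1), b k j = 0) ∧
      ∀ t : ℝ, 0 < t →
        f t = ∑ k ∈ Finset.range (n + 1), ∑ j ∈ Finset.range 4, (b k j : ℝ) / (t + k) ^ (j + 1) := by
  have hrefl : ∀ j, ∑ k ∈ Finset.range (n + 1), c (n - k) j =
      ∑ k ∈ Finset.range (n + 1), c k j := fun j => by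
    simpa using Finset.sum_range_reflect (fun k => c k j) (n + 1)
  refine ⟨fun k j => (c k j + (-1) ^ j * c (n - k) j) / 2, ?_, ?_⟩
  · intro j hj hj2
    rw [← Finset.sum_div, Finset.sum_add_distrib, ← Finset.mul_sum, hrefl]
    have hj4 := Finset.mem_range.mp hj
    interval_cases j
    · simp [hc0]
    · simp
    · exact absurd rfl hj2
    · norm_num
  · intro t ht
    have h1 := hc t (fun k _ => by positivity)
    have h2 := hc (-n - t) (fun k hk => by
      have : (k : ℝ) ≤ n := by exact_mod_cast Nat.lt_succ_iff.mp (Finset.mem_range.mp hk)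
      linarith)
    rw [hf, ← Finset.sum_range_reflect] at h2
    have h3 : f t = (f t - -f t) / 2 := by ring
    rw [h3, h2, h1, ← Finset.sum_sub_distrib, Finset.sum_div]
    refine Finset.sum_congr rfl fun k hk => ?_
    rw [← Finset.sum_sub_distrib, Finset.sum_div]
    refine Finset.sum_congr rfl fun j _ => ?_
    have hk' : k ≤ n := Nat.lt_succ_iff.mp (Finset.mem_range.mp hk)
    have e : (-(n : ℝ) - t + ((n + 1 - 1 - k : ℕ) : ℝ)) = -1 * (t + k) := by
      rw [Nat.add_sub_cancel, Nat.cast_sub hk']; ring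
    have hs : ((-1 : ℝ) ^ j) * (-1) ^ j = 1 := by rw [← mul_pow]; simp
    have hne : (-1 : ℝ) ^ j ≠ 0 := by simp
    have htk : t + k ≠ 0 := by positivity
    rw [e, mul_pow, pow_succ (-1 : ℝ) j, Nat.add_sub_cancel]
    push_cast
    field_simp
    linear_combination -(c (n - k) j : ℝ) * hs

theorem hasSum_shifted_zeta (a s : ℕ) (hs : 2 ≤ s) :
    ∃ q : ℚ, HasSum (fun ν : ℕ => 1 / ((a : ℝ) + ν) ^ s)
      ((∑' i : ℕ, 1 / (i : ℝ) ^ s) - q) := by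
  refine ⟨∑ i ∈ Finset.range a, 1 / (i : ℚ) ^ s, ?_⟩
  have h := (hasSum_nat_add_iff' a).mpr (Real.summable_one_div_nat_pow.mpr hs).hasSum
  push_cast at h ⊢
  simpa only [add_comm] using h

/-- Summing the derivative of a partial fraction expansion in which only the poles of order three
have nonvanishing coefficient sum gives a rational combination of `1` and `ζ(4)`. -/
theorem tsum_deriv_partialFraction (f : ℝ → ℝ) (n a : ℕ) (ha : 0 < a) (b : ℕ → ℕ → ℚ)
    (hb : ∀ j ∈ Finset.range 4, j ≠ 2 → ∑ k ∈ Finset.range (n + 1), b k j = 0)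
    (hf : ∀ t : ℝ, 0 < t →
      f t = ∑ k ∈ Finset.range (n + 1), ∑ j ∈ Finset.range 4, (b k j : ℝ) / (t + k) ^ (j + 1)) :
    ∃ q0 qz : ℚ, ∑' ν : ℕ, deriv f (a + ν) = q0 + qz * (Real.pi ^ 4 / 90) := by
  have hderiv : ∀ t : ℝ, 0 < t → deriv f t = ∑ k ∈ Finset.range (n + 1),
      ∑ j ∈ Finset.range 4, -((j + 1) * b k j : ℝ) * (1 / (t + k) ^ (j + 2)) := by
    intro t ht
    have h1 : f =ᶠ[nhds t] fun t => ∑ k ∈ Finset.range (n + 1),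
        ∑ j ∈ Finset.range 4, (b k j : ℝ) / (t + k) ^ (j + 1) := by
      filter_upwards [lt_mem_nhds ht] with x hx using hf x hx
    rw [h1.deriv_eq]
    refine HasDerivAt.deriv (HasDerivAt.fun_sum fun k _ => HasDerivAt.fun_sum fun j _ => ?_)
    have htk : t + k ≠ 0 := by positivity
    have h2 := (hasDerivAt_const t (b k j : ℝ)).fun_div
      (((hasDerivAt_id t).add_const (k : ℝ)).fun_pow (j + 1)) (pow_ne_zero _ htk)
    convert! h2 using 1
    simp only [id]
    push_cast
    field_simp
    simp only [zero_mul, zero_sub]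
    ring
  choose q hq using fun (k j : ℕ) => hasSum_shifted_zeta (a + k) (j + 2) (by omega)
  have hsum := hasSum_sum (s := Finset.range (n + 1)) fun k _ =>
    hasSum_sum (s := Finset.range 4) fun j _ => (hq k j).mul_left (-((j + 1) * b k j : ℝ))
  have ht : ∑' ν : ℕ, deriv f (a + ν) = ∑ k ∈ Finset.range (n + 1), ∑ j ∈ Finset.range 4,
      -((j + 1) * b k j : ℝ) * ((∑' i : ℕ, 1 / (i : ℝ) ^ (j + 2)) - q k j) := by
    rw [← hsum.tsum_eq]
    refine tsum_congr fun ν => ?_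
    rw [hderiv _ (by positivity)]
    refine Finset.sum_congr rfl fun k _ => Finset.sum_congr rfl fun j _ => ?_
    push_cast
    ring_nf
  have hb' : ∀ j ∈ Finset.range 4, j ≠ 2 → ∑ k ∈ Finset.range (n + 1), (b k j : ℝ) = 0 :=
    fun j hj hj2 => by exact_mod_cast hb j hj hj2
  refine ⟨∑ k ∈ Finset.range (n + 1), ∑ j ∈ Finset.range 4, (j + 1) * b k j * q k j,
    -3 * ∑ k ∈ Finset.range (n + 1), b k 2, ?_⟩
  have hz : ∑ k ∈ Finset.range (n + 1), ∑ j ∈ Finset.range 4,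
      -((j + 1) * b k j : ℝ) * (∑' i : ℕ, 1 / (i : ℝ) ^ (j + 2)) =
      -3 * (∑ k ∈ Finset.range (n + 1), (b k 2 : ℝ)) * (Real.pi ^ 4 / 90) := by
    rw [Finset.sum_comm, Finset.sum_eq_single 2]
    · rw [← hasSum_zeta_four.tsum_eq, ← Finset.sum_mul, Finset.mul_sum]
      congr 1
      refine Finset.sum_congr rfl fun k _ => ?_
      push_cast
      ring
    · intro j hj hj2
      rw [← Finset.sum_mul, Finset.sum_neg_distrib, ← Finset.mul_sum, hb' j hj hj2]
      simp
    · simp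
  rw [ht]
  simp only [mul_sub, Finset.sum_sub_distrib]
  rw [hz]
  push_cast
  simp only [neg_mul, Finset.sum_neg_distrib]
  ring

theorem poch_add (x : ℝ) (a b : ℕ) : poch x (a + b) = poch x a * poch (x + a) b := by
  simp only [poch, Finset.prod_range_add]
  push_cast
  simp only [add_assoc]

theorem poch_reflect (x : ℝ) (k : ℕ) : poch (1 - k - x) k = (-1) ^ k * poch x k := by
  simp only [poch]
  have h : (-1 : ℝ) ^ k = ∏ _i ∈ Finset.range k, (-1 : ℝ) := by simp
  rw [← Finset.prod_range_reflect, h, ← Finset.prod_mul_distrib]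
  refine Finset.prod_congr rfl fun i hi => ?_
  have := Finset.mem_range.mp hi
  rw [show k - 1 - i = k - (1 + i) by omega, Nat.cast_sub (by omega)]
  push_cast
  ring

open Polynomial in
theorem exists_polynomial_poch (a : ℚ) (k : ℕ) :
    ∃ P : ℚ[X], P.natDegree ≤ k ∧ ∀ t : ℝ, aeval t P = poch (t + a) k := by
  refine ⟨∏ i ∈ Finset.range k, (X + C (a + i)), ?_, fun t => ?_⟩
  · rw [natDegree_prod_of_monic _ _ fun i _ => monic_X_add_C _]
    simp only [natDegree_X_add_C, Finset.sum_const, Finset.card_range, smul_eq_mul, mul_one, le_refl]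
  · simp only [poch, map_prod, map_add, aeval_X, aeval_C]
    exact Finset.prod_congr rfl fun i _ => by simp [add_assoc]

/-- The summand with the common factors of its numerator and denominator cancelled. -/
noncomputable def reducedR (m d : ℕ) (t : ℝ) : ℝ :=
  (-1 : ℝ) ^ m * ((m + d).factorial : ℝ) ^ 2 / (m.factorial * (m + 2 * d).factorial) *
    (t + (m + d) / 2) * poch (t - (m + d)) m * poch (t + (m + 2 * d + 1)) m *
    poch (t - (m + 2 * d)) (m + 2 * d) * poch (t + (m + d + 1)) (m + 2 * d) /
    poch t (m + d + 1) ^ 4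

theorem R_eq_reducedR (m d : ℕ) (t : ℝ) (ht : 0 < t) : R (m + d) m t = reducedR m d t := by
  have hp : ∀ (x : ℝ) (k : ℕ), 0 < x → poch x k ≠ 0 := fun x k hx =>
    (Finset.prod_pos fun i _ => by positivity).ne'
  unfold R reducedR
  rw [show 2 * (m + d) - m = m + 2 * d by omega,
    show m + 2 * d + 1 = (m + d + 1) + d by omega, poch_add t (m + d + 1) d,
    add_comm m d, poch_add _ d m]
  have h1 := hp t (d + m + 1) ht
  have h2 := hp (t + (d + m + 1 : ℕ)) d (by positivity)
  push_cast at h2 ⊢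
  rw [show t - 2 * ((d : ℝ) + m) + m = t - (m + 2 * d) by ring,
    show t + ((d : ℝ) + m) + 1 + d = t + (m + 2 * d + 1) by ring,
    show t + ((d : ℝ) + m) + 1 = t + (d + m + 1) by ring,
    add_comm (m : ℝ) d]
  field_simp

theorem reducedR_reflect (m d : ℕ) (t : ℝ) :
    reducedR m d (-((m + d : ℕ) : ℝ) - t) = -reducedR m d t := by
  have h1 := poch_reflect (t + (m + 2 * d + 1)) m
  have h2 := poch_reflect (t - (m + d)) m
  have h3 := poch_reflect (t + (m + d + 1)) (m + 2 * d)
  have h4 := poch_reflect (t - (m + 2 * d)) (m + 2 * d)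
  have h5 := poch_reflect t (m + d + 1)
  unfold reducedR
  push_cast at *
  rw [show -((m : ℝ) + d) - t - (m + d) = 1 - m - (t + (m + 2 * d + 1)) by ring, h1,
    show -((m : ℝ) + d) - t + (m + 2 * d + 1) = 1 - m - (t - (m + d)) by ring, h2,
    show -((m : ℝ) + d) - t - (m + 2 * d) = 1 - (m + 2 * d) - (t + (m + d + 1)) by ring, h3,
    show -((m : ℝ) + d) - t + (m + d + 1) = 1 - (m + 2 * d) - (t - (m + 2 * d)) by ring, h4,
    show -((m : ℝ) + d) - t = 1 - (m + d + 1) - t by ring, h5]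
  have hs : ∀ k : ℕ, ((-1 : ℝ) ^ k) * (-1) ^ k = 1 := fun k => by rw [← mul_pow]; simp
  have h4 : ((-1 : ℝ) ^ (m + d + 1)) ^ 4 = 1 := by rw [← pow_mul, mul_comm, pow_mul]; norm_num
  rw [mul_pow, h4, one_mul]
  linear_combination -((-1 : ℝ) ^ m * ((m + d).factorial : ℝ) ^ 2 /
    (m.factorial * (m + 2 * d).factorial) * (t + (m + d) / 2) * poch (t - (m + d)) m *
    poch (t + (m + 2 * d + 1)) m * poch (t - (m + 2 * d)) (m + 2 * d) *
    poch (t + (m + d + 1)) (m + 2 * d) / poch t (m + d + 1) ^ 4) *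
    (hs m * ((-1) ^ (m + 2 * d) * (-1) ^ (m + 2 * d)) + hs (m + 2 * d))

open Polynomial in
theorem exists_numerator_reducedR (m d : ℕ) : ∃ N : ℚ[X], N.natDegree + 1 < 4 * (m + d + 1) ∧
    ∀ t : ℝ, reducedR m d t = aeval t N / (∏ k ∈ Finset.range (m + d + 1), (t + k)) ^ 4 := by
  obtain ⟨P1, hd1, hP1⟩ := exists_polynomial_poch (-(m + d)) m
  obtain ⟨P2, hd2, hP2⟩ := exists_polynomial_poch (m + 2 * d + 1) m
  obtain ⟨P3, hd3, hP3⟩ := exists_polynomial_poch (-(m + 2 * d)) (m + 2 * d)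
  obtain ⟨P4, hd4, hP4⟩ := exists_polynomial_poch (m + d + 1) (m + 2 * d)
  refine ⟨C ((-1 : ℚ) ^ m * ((m + d).factorial : ℚ) ^ 2 / (m.factorial * (m + 2 * d).factorial)) *
    (X + C (((m : ℚ) + d) / 2)) * P1 * P2 * P3 * P4, ?_, fun t => ?_⟩
  · have h := natDegree_mul_le_of_le (natDegree_mul_le_of_le (natDegree_mul_le_of_le
      (natDegree_mul_le_of_le (natDegree_mul_le_of_le
        (natDegree_C ((-1 : ℚ) ^ m * ((m + d).factorial : ℚ) ^ 2 /
          (m.factorial * (m + 2 * d).factorial))).le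
        (natDegree_X_add_C (((m : ℚ) + d) / 2)).le) hd1) hd2) hd3) hd4
    omega
  · simp only [map_mul, hP1, hP2, hP3, hP4, map_add, aeval_X, aeval_C, reducedR]
    simp [poch, sub_eq_add_neg]

/-- For all integers `n ≥ m ≥ 0`, `Z_l(n,m)` is a `ℚ`-linear combination of `1`, `ζ(4)` and
`U_4(n), …, U_9(n)`. -/
theorem Zl_in_terms_of_zeta4_and_U (n m : ℕ) (hmn : m ≤ n) :
    ∃ q0 qz q4 q5 q6 q7 q8 q9 : ℚ,
      Zl n m = q0 + qz * (Real.pi ^ 4 / 90) + q4 * U 4 n + q5 * U 5 n + q6 * U 6 n +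
        q7 * U 7 n + q8 * U 8 n + q9 * U 9 n := by
  obtain ⟨d, rfl⟩ := Nat.exists_eq_add_of_le hmn
  obtain ⟨N, hN, hRN⟩ := exists_numerator_reducedR m d
  obtain ⟨c, hc0, hc⟩ := exists_partialFraction N (m + d) hN
  obtain ⟨b, hb, hf⟩ := exists_partialFraction_of_reflect (reducedR m d) (m + d)
    (reducedR_reflect m d) c hc0 (fun t ht => by rw [hRN, hc t ht])
  obtain ⟨q0, qz, hq⟩ := tsum_deriv_partialFraction (R (m + d) m) (m + d) (d + 1) d.succ_pos b hb
    (fun t ht => by rw [R_eq_reducedR m d t ht, hf t ht])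
  refine ⟨-(1 / 3) * q0, -(1 / 3) * qz, 0, 0, 0, 0, 0, 0, ?_⟩
  have ha : ((m + d : ℕ) : ℝ) - m + 1 = ((d + 1 : ℕ) : ℝ) := by push_cast; ring
  rw [Zl, ha, hq]
  push_cast
  ring
end

section
/- For all integers n, m with 0 ≤ m ≤ n-2, the left-hand side Z_l of the ζ(4) identity satisfies the second-order linear recurrence a₀(n,m) Z_l(n,m) + a₁(n,m) Z_l(n,m+1) + a₂(n,m) Z_l(n,m+2) = 0, where a₀(n,m) = (2n-m)⁵, a₁(n,m) = -(4n-2m-1)(6n⁴-24n³m+22n²m²-8nm³+m⁴-24n³+30n²m-14nm²+2m³+8n²-10nm+2m²-4n+m), and a₂(n,m) = -(2n-m-1)³(4n-m)(m+2). -/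
open scoped BigOperators

section Pochhammer

lemma poch_succ (x : ℝ) (k : ℕ) : poch x (k + 1) = poch x k * (x + k) :=
  Finset.prod_range_succ _ _

lemma poch_succ_left (x : ℝ) (k : ℕ) : poch x (k + 1) = x * poch (x + 1) k := by
  simp only [poch, Finset.prod_range_succ', Nat.cast_add, Nat.cast_one, Nat.cast_zero, add_zero]
  rw [mul_comm]
  congr 1
  exact Finset.prod_congr rfl fun i _ => by ring

lemma poch_add_one_mul (x : ℝ) (k : ℕ) : poch (x + 1) k * x = poch x k * (x + k) := by
  rw [← poch_succ, poch_succ_left, mul_comm]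

lemma poch_pos {x : ℝ} (hx : 0 < x) (k : ℕ) : 0 < poch x k :=
  Finset.prod_pos fun i _ => by positivity

lemma poch_eq_zero {x : ℝ} {k i : ℕ} (hi : i < k) (hx : x + i = 0) : poch x k = 0 :=
  Finset.prod_eq_zero (Finset.mem_range.2 hi) hx

end Pochhammer

section RationalFunction

open Polynomial Filter Topology Asymptotics

/-- The polynomial `(X + a)_k`. -/
noncomputable def pochPoly (a : ℝ) (k : ℕ) : ℝ[X] := ∏ i ∈ Finset.range k, (X + C (a + i))

lemma eval_pochPoly (a t : ℝ) (k : ℕ) : (pochPoly a k).eval t = poch (t + a) k := by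
  simp [pochPoly, poch, eval_prod, add_assoc]

lemma monic_pochPoly (a : ℝ) (k : ℕ) : (pochPoly a k).Monic :=
  monic_prod_of_monic _ _ fun _ _ => monic_X_add_C _

lemma natDegree_pochPoly (a : ℝ) (k : ℕ) : (pochPoly a k).natDegree = k := by
  rw [pochPoly, natDegree_prod_of_monic _ _ fun _ _ => monic_X_add_C _]
  simp only [natDegree_X_add_C, Finset.sum_const, Finset.card_range, smul_eq_mul, mul_one]

lemma hasDerivAt_eval_div (p q : ℝ[X]) {t : ℝ} (ht : q.eval t ≠ 0) :
    HasDerivAt (fun x => p.eval x / q.eval x)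
      ((derivative p * q - p * derivative q).eval t / (q ^ 2).eval t) t := by
  rw [eval_sub, eval_mul, eval_mul, eval_pow]
  exact (p.hasDerivAt t).div (q.hasDerivAt t) ht

lemma deriv_eval_div_eq_zero {p q a b : ℝ[X]} {t : ℝ} (hq : q.eval t ≠ 0) (hab : a * b ∣ p)
    (ha : a.eval t = 0) (hb : b.eval t = 0) : deriv (fun x => p.eval x / q.eval x) t = 0 := by
  obtain ⟨c, rfl⟩ := hab
  rw [(hasDerivAt_eval_div _ q hq).deriv]
  simp [ha, hb]

lemma natDegree_wronskian_le (p q : ℝ[X]) {d e : ℕ} (hp : p.natDegree ≤ d) (hq : q.natDegree ≤ e) :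
    (X * (derivative p * q - p * derivative q)).natDegree ≤ d + e := by
  have key : ∀ f g : ℝ[X], (X * (derivative f * g)).natDegree ≤ f.natDegree + g.natDegree := by
    intro f g
    rcases Nat.eq_zero_or_pos f.natDegree with h | h
    · rw [derivative_of_natDegree_zero h]
      simp
    · have h1 := natDegree_derivative_lt h.ne'
      have h2 := natDegree_mul_le (p := derivative f) (q := g)
      have h3 := natDegree_mul_le (p := X) (q := derivative f * g)
      have h4 := natDegree_X_le (R := ℝ)
      omega
  rw [mul_sub]
  refine (natDegree_sub_le _ _).trans (max_le ((key p q).trans (by omega)) ?_)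
  rw [mul_comm p]
  exact (key q p).trans (by omega)

/-- The derivative of a rational function `p / q` with `deg p + r ≤ deg q` is `O(x ^ (-(r + 1)))`
at infinity. -/
lemma isBigO_deriv_eval_div (p q : ℝ[X]) {r : ℕ} (hq : q ≠ 0)
    (h : p.natDegree + r ≤ q.natDegree) :
    (deriv fun x => p.eval x / q.eval x) =O[atTop] fun x : ℝ => (x ^ (r + 1))⁻¹ := by
  set w := derivative p * q - p * derivative q with hw
  have hdeg : (X ^ (r + 1) * w).degree ≤ (q ^ 2).degree := by
    rw [degree_eq_natDegree (pow_ne_zero 2 hq)]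
    refine degree_le_of_natDegree_le ?_
    have h1 := natDegree_wronskian_le p q le_rfl le_rfl
    rw [← hw] at h1
    have h2 := natDegree_mul_le (p := X ^ r) (q := X * w)
    have h3 := natDegree_X_pow_le (R := ℝ) r
    rw [natDegree_pow, pow_succ, mul_assoc]
    omega
  have hO := Polynomial.isBigO_atTop_of_degree_le _ _ hdeg
  have hne : ∀ᶠ x : ℝ in atTop, q.eval x ≠ 0 := by
    filter_upwards [Polynomial.eventually_atTop_not_isRoot q hq] with x hx using hx
  have hO' := hO.mul (isBigO_refl (fun x : ℝ => (x ^ (r + 1))⁻¹ * ((q ^ 2).eval x)⁻¹) atTop)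
  refine (hO'.congr' ?_ ?_)
  · filter_upwards [hne, eventually_gt_atTop 0] with x hx hx0
    rw [(hasDerivAt_eval_div p q hx).deriv, ← hw, eval_mul, eval_pow, eval_X]
    field_simp
  · filter_upwards [hne] with x hx
    rw [eval_pow]
    field_simp

end RationalFunction

section Recurrence

open Polynomial Filter Topology Asymptotics

/-- The numerator of `R n m` as a polynomial. -/
noncomputable def numR (n m : ℕ) : ℝ[X] :=
  pochPoly (-n) m * pochPoly (-2 * n + m) (2 * n - m) *
    (C ((-1) ^ m * (n.factorial : ℝ) ^ 2 / (m.factorial * (2 * n - m).factorial)) *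
      (X + C (n / 2 : ℝ)) * pochPoly (n + 1) n * pochPoly (n + 1) (2 * n - m))

/-- The denominator of `R n m` as a polynomial. -/
noncomputable def denR (n m : ℕ) : ℝ[X] := pochPoly 0 (n + 1) ^ 3 * pochPoly 0 (2 * n - m + 1)

lemma monic_denR (n m : ℕ) : (denR n m).Monic :=
  ((monic_pochPoly _ _).pow 3).mul (monic_pochPoly _ _)

lemma natDegree_denR (n m : ℕ) : (denR n m).natDegree = 3 * (n + 1) + (2 * n - m + 1) := by
  rw [denR, ((monic_pochPoly _ _).pow 3).natDegree_mul (monic_pochPoly _ _),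
    (monic_pochPoly _ _).natDegree_pow, natDegree_pochPoly, natDegree_pochPoly]

lemma eval_denR_pos (n m : ℕ) {t : ℝ} (ht : 0 < t) : 0 < (denR n m).eval t := by
  simp only [denR, eval_mul, eval_pow, eval_pochPoly, add_zero]
  exact mul_pos (pow_pos (poch_pos ht _) _) (poch_pos ht _)

lemma natDegree_numR_le (n m : ℕ) :
    (numR n m).natDegree ≤ m + (2 * n - m) + (1 + n + (2 * n - m)) := by
  have h := fun a k => (natDegree_pochPoly a k).le
  exact natDegree_mul_le_of_le (natDegree_mul_le_of_le (h _ _) (h _ _))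
    (natDegree_mul_le_of_le (natDegree_mul_le_of_le
      ((natDegree_C_mul_le _ _).trans (natDegree_X_add_C _).le) (h _ _)) (h _ _))

lemma R_eq_eval_div (n m : ℕ) : R n m = fun t => (numR n m).eval t / (denR n m).eval t := by
  funext t
  simp only [R, numR, denR, eval_mul, eval_pow, eval_pochPoly, eval_add, eval_C, eval_X, add_zero,
    ← sub_eq_add_neg, ← add_assoc, neg_mul, div_eq_mul_inv, mul_inv, mul_pow]
  ring

lemma differentiableAt_R (n m : ℕ) {t : ℝ} (ht : 0 < t) : DifferentiableAt ℝ (R n m) t := by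
  rw [R_eq_eval_div]
  exact (hasDerivAt_eval_div _ _ (eval_denR_pos n m ht).ne').differentiableAt

lemma summable_deriv_R {n m : ℕ} (hmn : m ≤ n) (a : ℕ) :
    Summable fun ν : ℕ => deriv (R n m) (a + ν) := by
  have hO : (deriv (R n m)) =O[atTop] fun x : ℝ => (x ^ 2)⁻¹ := by
    rw [R_eq_eval_div]
    refine isBigO_deriv_eval_div (r := 1) _ _ (monic_denR n m).ne_zero ?_
    have := natDegree_numR_le n m
    rw [natDegree_denR]
    omega
  have hs : Summable fun ν : ℕ => deriv (R n m) ν :=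
    summable_of_isBigO_nat (Real.summable_nat_pow_inv.2 one_lt_two)
      (hO.comp_tendsto tendsto_natCast_atTop_atTop)
  simpa [add_comm] using (summable_nat_add_iff a).2 hs

lemma deriv_R_eq_zero {n m i : ℕ} (hmn : m ≤ n) (hi : i < m) :
    deriv (R n m) ((n : ℝ) - m + 1 + i) = 0 := by
  have hm : (m : ℝ) ≤ n := by exact_mod_cast hmn
  have ht : 0 < (n : ℝ) - m + 1 + i := by linarith [Nat.cast_nonneg (α := ℝ) i]
  rw [R_eq_eval_div]
  refine deriv_eval_div_eq_zero (a := pochPoly (-n) m) (b := pochPoly (-2 * n + m) (2 * n - m))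
    (eval_denR_pos n m ht).ne' ?_ ?_ ?_
  · exact dvd_mul_right _ _
  · rw [eval_pochPoly]
    refine poch_eq_zero (i := m - 1 - i) (by omega) ?_
    rw [Nat.cast_sub (by omega), Nat.cast_sub (by omega)]
    push_cast
    ring
  · rw [eval_pochPoly]
    refine poch_eq_zero (i := n - 1 - i) (by omega) ?_
    rw [Nat.cast_sub (by omega), Nat.cast_sub (by omega)]
    push_cast
    ring

/-- The terms of `Zl n m` with `ν ≤ n` vanish. -/
lemma Zl_eq_tsum {n m : ℕ} (hmn : m ≤ n) :
    Zl n m = -(1 / 3) * ∑' ν : ℕ, deriv (R n m) ((n + 1 : ℕ) + ν) := by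
  have hs : Summable fun ν : ℕ => deriv (R n m) ((n : ℝ) - m + 1 + ν) := by
    simpa [Nat.cast_sub hmn] using summable_deriv_R hmn (n - m + 1)
  rw [Zl, ← hs.sum_add_tsum_nat_add m,
    Finset.sum_eq_zero fun i hi => deriv_R_eq_zero hmn (Finset.mem_range.1 hi), zero_add]
  congr 2
  funext ν
  congr 1
  push_cast
  ring

/-- The numerator of the telescoping certificate, whose denominator is `denR n m`; here
`k = 2 * n - m - 2`. -/
noncomputable def numCert (n m k : ℕ) : ℝ[X] :=
  (X + C (-n - 1 : ℝ)) * ((X + C (-k - 1 : ℝ)) * pochPoly (-k) k) *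
    (C (-((-1) ^ m * (n.factorial : ℝ) ^ 2 / (m.factorial * (k + 2).factorial) *
        ((k + 2) * n * (2 * k + 3) / (m + 1)))) * (X + C (k + 2 : ℝ)) *
      (X + C (n : ℝ)) ^ 5 * pochPoly (-n) m * pochPoly (n + 1) n * pochPoly (n + 1) k)

/-- The telescoping certificate. -/
noncomputable def cert (n m k : ℕ) (t : ℝ) : ℝ := (numCert n m k).eval t / (denR n m).eval t

lemma natDegree_numCert_le (n m k : ℕ) :
    (numCert n m k).natDegree ≤ 1 + (1 + k) + (1 + 5 + m + n + k) := by
  have h := fun a k => (natDegree_pochPoly a k).le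
  have hX := fun a : ℝ => (natDegree_X_add_C a).le
  have h5 : ((X + C (n : ℝ)) ^ 5).natDegree ≤ 5 := by
    rw [natDegree_pow, natDegree_X_add_C]
  exact natDegree_mul_le_of_le (natDegree_mul_le_of_le (hX _) (natDegree_mul_le_of_le (hX _) (h _ _)))
    (natDegree_mul_le_of_le (natDegree_mul_le_of_le (natDegree_mul_le_of_le (natDegree_mul_le_of_le
      ((natDegree_C_mul_le _ _).trans (hX _)) h5) (h _ _)) (h _ _)) (h _ _))

lemma differentiableAt_cert (n m k : ℕ) {t : ℝ} (ht : 0 < t) :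
    DifferentiableAt ℝ (cert n m k) t :=
  (hasDerivAt_eval_div _ _ (eval_denR_pos n m ht).ne').differentiableAt

lemma tendsto_deriv_cert {n m k : ℕ} (hk : 2 * n = m + k + 2) :
    Tendsto (deriv (cert n m k)) atTop (𝓝 0) := by
  refine (isBigO_deriv_eval_div (r := 0) _ _ (monic_denR n m).ne_zero ?_).trans_tendsto ?_
  · have := natDegree_numCert_le n m k
    rw [natDegree_denR]
    omega
  · simpa using tendsto_inv_atTop_zero (𝕜 := ℝ)

lemma deriv_cert_eq_zero {n m k : ℕ} (hk : 2 * n = m + k + 2) (hmn : m + 2 ≤ n) :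
    deriv (cert n m k) (n + 1) = 0 := by
  refine deriv_eval_div_eq_zero (a := X + C (-n - 1 : ℝ))
    (b := (X + C (-k - 1 : ℝ)) * pochPoly (-k) k)
    (eval_denR_pos n m (by positivity)).ne' ?_ ?_ ?_
  · exact dvd_mul_right _ _
  · simp
  · have h : (n : ℝ) + 1 + (-k - 1) + (n - m - 2 : ℕ) = 0 := by
      rw [Nat.cast_sub (by omega), Nat.cast_sub (by omega)]
      have : (2 * n : ℝ) = m + k + 2 := by exact_mod_cast hk
      push_cast
      linarith
    rw [eval_mul, eval_pochPoly, eval_add, eval_X, eval_C]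
    convert poch_eq_zero (k := k + 1) (by omega) h using 1
    rw [poch_succ_left]
    congr 2
    ring

/-- The factor common to `R n m`, `R n (m + 1)`, `R n (m + 2)` and the certificate; here
`k = 2 * n - m - 2`. -/
noncomputable def commonFactor (n m k : ℕ) (t : ℝ) : ℝ :=
  (-1) ^ m * (n.factorial : ℝ) ^ 2 / (m.factorial * (k + 2).factorial) * poch (t - n) m *
    poch (t - k) k * poch (t + n + 1) n * poch (t + n + 1) k /
    (poch t (n + 1) ^ 3 * poch t (k + 3))

lemma poch_sub_add_one (t : ℝ) (k : ℕ) :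
    poch (t - (k + 1)) (k + 1) = (t - k - 1) * poch (t - k) k := by
  rw [poch_succ_left, show t - (k + 1) + 1 = t - k by ring, sub_sub]

lemma poch_sub_add_two (t : ℝ) (k : ℕ) :
    poch (t - (k + 2)) (k + 2) = (t - k - 2) * ((t - k - 1) * poch (t - k) k) := by
  rw [poch_succ_left, show t - (k + 2) + 1 = t - (k + 1) by ring, poch_sub_add_one, sub_sub t]
  ring

lemma R_eq_commonFactor {n m k : ℕ} (hk : 2 * n = m + k + 2) (t : ℝ) :
    R n m t = (t + n / 2) * ((t - k - 2) * (t - k - 1) * (t + n + 1 + k) * (t + n + 2 + k)) *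
      commonFactor n m k t := by
  have hk' : t - 2 * n + m = t - (k + 2) := by
    have : (2 * n : ℝ) = m + k + 2 := by exact_mod_cast hk
    linarith
  rw [R, show 2 * n - m = k + 2 by omega, hk', poch_sub_add_two, poch_succ (t + n + 1) (k + 1),
    poch_succ (t + n + 1) k, commonFactor]
  simp only [div_eq_mul_inv, mul_inv, mul_pow]
  push_cast
  ring

lemma R_succ_eq_commonFactor {n m k : ℕ} (hk : 2 * n = m + k + 2) {t : ℝ} (ht : 0 < t) :
    R n (m + 1) t = -((k + 2) / (m + 1)) * (t + n / 2) *
      ((t - n + m) * (t - k - 1) * (t + n + 1 + k) * (t + k + 2)) * commonFactor n m k t := by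
  have hk' : t - 2 * n + (m + 1 : ℕ) = t - (k + 1) := by
    have : (2 * n : ℝ) = m + k + 2 := by exact_mod_cast hk
    push_cast
    linarith
  have h1 := (poch_pos ht (n + 1)).ne'
  have h2 := (poch_pos ht (k + 2)).ne'
  rw [R, show 2 * n - (m + 1) = k + 1 by omega, hk', poch_sub_add_one, poch_succ (t + n + 1) k,
    commonFactor, poch_succ (t - n) m, poch_succ t (k + 2), Nat.factorial_succ m,
    Nat.factorial_succ (k + 1)]
  push_cast
  field_simp
  ring

lemma R_succ_succ_eq_commonFactor {n m k : ℕ} (hk : 2 * n = m + k + 2) {t : ℝ} (ht : 0 < t) :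
    R n (m + 2) t = (k + 2) * (k + 1) / ((m + 1) * (m + 2)) * (t + n / 2) *
      ((t - n + m) * (t - n + m + 1) * (t + k + 1) * (t + k + 2)) * commonFactor n m k t := by
  have hk' : t - 2 * n + (m + 2 : ℕ) = t - k := by
    have : (2 * n : ℝ) = m + k + 2 := by exact_mod_cast hk
    push_cast
    linarith
  have h1 := (poch_pos ht (n + 1)).ne'
  have h2 := (poch_pos ht (k + 1)).ne'
  rw [R, show 2 * n - (m + 2) = k by omega, hk', commonFactor, poch_succ (t - n) (m + 1),
    poch_succ (t - n) m, poch_succ t (k + 2), poch_succ t (k + 1), Nat.factorial_succ (m + 1),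
    Nat.factorial_succ m, Nat.factorial_succ (k + 1), Nat.factorial_succ k]
  push_cast
  field_simp
  ring

lemma cert_eq_commonFactor {n m k : ℕ} (hk : 2 * n = m + k + 2) (t : ℝ) :
    cert n m k t = -((k + 2) * n * (2 * k + 3) / (m + 1)) *
      ((t - n - 1) * (t - k - 1) * (t + k + 2) * (t + n) ^ 5) * commonFactor n m k t := by
  rw [cert, numCert, denR, commonFactor, show 2 * n - m + 1 = k + 3 by omega]
  simp only [eval_mul, eval_pow, eval_pochPoly, eval_add, eval_C, eval_X, add_zero,
    ← sub_eq_add_neg, ← add_assoc, div_eq_mul_inv, mul_inv]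
  ring

lemma commonFactor_add_one (n m k : ℕ) {t : ℝ} (ht : 0 < t) :
    (t - n) * (t - k) * (t + k + 3) * (t + n + 1) ^ 5 * commonFactor n m k (t + 1) =
      (t - n + m) * (t + 2 * n + 1) * (t + n + 1 + k) * t ^ 5 * commonFactor n m k t := by
  have hA := poch_add_one_mul (t - n) m
  have hB := poch_add_one_mul (t - k) k
  have hD := poch_add_one_mul (t + n + 1) n
  have hE := poch_add_one_mul (t + n + 1) k
  have hP : poch (t + 1) (n + 1) = poch t (n + 1) * (t + n + 1) / t := by
    rw [eq_div_iff ht.ne', poch_add_one_mul]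
    push_cast
    ring
  have hQ : poch (t + 1) (k + 3) = poch t (k + 3) * (t + k + 3) / t := by
    rw [eq_div_iff ht.ne', poch_add_one_mul]
    push_cast
    ring
  have hnum : (poch (t + 1 - n) m * poch (t + 1 - k) k * poch (t + 1 + n + 1) n *
      poch (t + 1 + n + 1) k) * ((t - n) * (t - k) * (t + n + 1) ^ 2) =
      (poch (t - n) m * poch (t - k) k * poch (t + n + 1) n * poch (t + n + 1) k) *
        ((t - n + m) * t * (t + 2 * n + 1) * (t + n + 1 + k)) := by
    rw [show t + 1 - n = t - n + 1 by ring, show t + 1 - k = t - k + 1 by ring,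
      show t + 1 + n + 1 = t + n + 1 + 1 by ring]
    calc _ = poch (t - n + 1) m * (t - n) * (poch (t - k + 1) k * (t - k)) *
          (poch (t + n + 1 + 1) n * (t + n + 1)) * (poch (t + n + 1 + 1) k * (t + n + 1)) := by ring
      _ = _ := by
        rw [hA, hB, hD, hE]
        ring
  have h1 := (poch_pos ht (n + 1)).ne'
  have h2 := (poch_pos ht (k + 3)).ne'
  have h3 : t + n + 1 ≠ 0 := by positivity
  have h4 : t + k + 3 ≠ 0 := by positivity
  have h5 := ht.ne'
  rw [commonFactor, commonFactor, hP, hQ]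
  set K := (-1) ^ m * (n.factorial : ℝ) ^ 2 / (m.factorial * (k + 2).factorial)
  field_simp
  linear_combination K * hnum

lemma certificate_identity {n m k : ℝ} (hm : 0 ≤ m) (hk : 2 * n = m + k + 2) (t : ℝ) :
    (2 * n - m) ^ 5 * ((t + n / 2) *
        ((t - k - 2) * (t - k - 1) * (t + n + 1 + k) * (t + n + 2 + k)))
      - (4 * n - 2 * m - 1) *
        (6 * n ^ 4 - 24 * n ^ 3 * m + 22 * n ^ 2 * m ^ 2 - 8 * n * m ^ 3 + m ^ 4 - 24 * n ^ 3
          + 30 * n ^ 2 * m - 14 * n * m ^ 2 + 2 * m ^ 3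
          + 8 * n ^ 2 - 10 * n * m + 2 * m ^ 2 - 4 * n + m) *
        (-((k + 2) / (m + 1)) * (t + n / 2) *
          ((t - n + m) * (t - k - 1) * (t + n + 1 + k) * (t + k + 2)))
      - (2 * n - m - 1) ^ 3 * (4 * n - m) * (m + 2) *
        ((k + 2) * (k + 1) / ((m + 1) * (m + 2)) * (t + n / 2) *
          ((t - n + m) * (t - n + m + 1) * (t + k + 1) * (t + k + 2))) =
      -((k + 2) * n * (2 * k + 3) / (m + 1)) *
        ((t - n + m) * (t + 2 * n + 1) * (t + n + 1 + k) * t ^ 5 -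
          (t - n - 1) * (t - k - 1) * (t + k + 2) * (t + n) ^ 5) := by
  obtain rfl : k = 2 * n - m - 2 := by linarith
  have h1 : m + 1 ≠ 0 := by positivity
  have h2 : m + 2 ≠ 0 := by positivity
  field_simp
  ring

/-- The left-hand side of the recurrence in `m`, applied to three consecutive terms. -/
def recurrenceOp (n m : ℝ) (f₀ f₁ f₂ : ℝ) : ℝ :=
  (2 * n - m) ^ 5 * f₀
    - (4 * n - 2 * m - 1) *
      (6 * n ^ 4 - 24 * n ^ 3 * m + 22 * n ^ 2 * m ^ 2 - 8 * n * m ^ 3 + m ^ 4 - 24 * n ^ 3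
        + 30 * n ^ 2 * m - 14 * n * m ^ 2 + 2 * m ^ 3
        + 8 * n ^ 2 - 10 * n * m + 2 * m ^ 2 - 4 * n + m) * f₁
    - (2 * n - m - 1) ^ 3 * (4 * n - m) * (m + 2) * f₂

lemma recurrenceOp_R {n m k : ℕ} (hk : 2 * n = m + k + 2) {t : ℝ} (ht : 0 < t) :
    recurrenceOp n m (R n m t) (R n (m + 1) t) (R n (m + 2) t) =
      cert n m k (t + 1) - cert n m k t := by
  rw [R_eq_commonFactor hk, R_succ_eq_commonFactor hk ht, R_succ_succ_eq_commonFactor hk ht,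
    cert_eq_commonFactor hk, cert_eq_commonFactor hk, recurrenceOp]
  have hk' : 2 * (n : ℝ) = m + k + 2 := by exact_mod_cast hk
  have hid := certificate_identity m.cast_nonneg hk' t
  have hshift := commonFactor_add_one n m k ht
  linear_combination commonFactor n m k t * hid + ((k + 2) * n * (2 * k + 3) / (m + 1)) * hshift

lemma recurrenceOp_deriv_R {n m k : ℕ} (hk : 2 * n = m + k + 2) {t : ℝ} (ht : 0 < t) :
    recurrenceOp n m (deriv (R n m) t) (deriv (R n (m + 1)) t) (deriv (R n (m + 2)) t) =
      deriv (cert n m k) (t + 1) - deriv (cert n m k) t := by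
  have hl : HasDerivAt (fun x => recurrenceOp n m (R n m x) (R n (m + 1) x) (R n (m + 2) x))
      (recurrenceOp n m (deriv (R n m) t) (deriv (R n (m + 1)) t) (deriv (R n (m + 2)) t)) t :=
    (((differentiableAt_R n m ht).hasDerivAt.const_mul _).sub
      ((differentiableAt_R n (m + 1) ht).hasDerivAt.const_mul _)).sub
      ((differentiableAt_R n (m + 2) ht).hasDerivAt.const_mul _)
  have hr : HasDerivAt (fun x => cert n m k (x + 1) - cert n m k x)
      (deriv (cert n m k) (t + 1) - deriv (cert n m k) t) t :=
    ((differentiableAt_cert n m k (by positivity)).hasDerivAt.comp_add_const t 1).sub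
      (differentiableAt_cert n m k ht).hasDerivAt
  refine hl.unique (hr.congr_of_eventuallyEq ?_)
  filter_upwards [eventually_gt_nhds ht] with x hx using recurrenceOp_R hk hx

lemma hasSum_recurrenceOp {n m : ℝ} {f₀ f₁ f₂ : ℕ → ℝ} (h₀ : Summable f₀) (h₁ : Summable f₁)
    (h₂ : Summable f₂) :
    HasSum (fun ν => recurrenceOp n m (f₀ ν) (f₁ ν) (f₂ ν))
      (recurrenceOp n m (∑' ν, f₀ ν) (∑' ν, f₁ ν) (∑' ν, f₂ ν)) :=
  ((h₀.hasSum.mul_left _).sub (h₁.hasSum.mul_left _)).sub (h₂.hasSum.mul_left _)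

lemma recurrenceOp_tsum_deriv_R {n m : ℕ} (hmn : m + 2 ≤ n) :
    recurrenceOp n m (∑' ν : ℕ, deriv (R n m) ((n + 1 : ℕ) + ν))
      (∑' ν : ℕ, deriv (R n (m + 1)) ((n + 1 : ℕ) + ν))
      (∑' ν : ℕ, deriv (R n (m + 2)) ((n + 1 : ℕ) + ν)) = 0 := by
  obtain ⟨k, hk⟩ : ∃ k, 2 * n = m + k + 2 := ⟨2 * n - m - 2, by omega⟩
  have hsum := (hasSum_recurrenceOp (n := n) (m := m)
    (summable_deriv_R (n := n) (m := m) (by omega) (n + 1))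
    (summable_deriv_R (n := n) (m := m + 1) (by omega) (n + 1))
    (summable_deriv_R (n := n) (m := m + 2) (by omega) (n + 1))).tendsto_sum_nat
  refine tendsto_nhds_unique hsum ?_
  have hterm : ∀ ν : ℕ, recurrenceOp n m (deriv (R n m) ((n + 1 : ℕ) + ν))
      (deriv (R n (m + 1)) ((n + 1 : ℕ) + ν)) (deriv (R n (m + 2)) ((n + 1 : ℕ) + ν)) =
      deriv (cert n m k) ((n + 1 : ℕ) + (ν + 1 : ℕ)) -
        deriv (cert n m k) ((n + 1 : ℕ) + ν) := by
    intro ν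
    rw [recurrenceOp_deriv_R hk (by positivity)]
    push_cast
    rw [add_assoc ((n : ℝ) + 1)]
  simp_rw [hterm, Finset.sum_range_sub fun ν : ℕ => deriv (cert n m k) ((n + 1 : ℕ) + ν)]
  have h0 : deriv (cert n m k) ((n + 1 : ℕ) + (0 : ℕ)) = 0 := by
    simpa using deriv_cert_eq_zero hk hmn
  simp only [h0, sub_zero]
  exact (tendsto_deriv_cert hk).comp
    (tendsto_atTop_add_const_left _ _ tendsto_natCast_atTop_atTop)

end Recurrence

/-- The second-order recurrence in `m` satisfied by `Z_l(n,m)` for `0 ≤ m ≤ n - 2`. -/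
theorem Zl_recurrence (n m : ℕ) (hmn : m + 2 ≤ n) :
    (2 * (n : ℝ) - m) ^ 5 * Zl n m
      - (4 * (n : ℝ) - 2 * m - 1) *
        (6 * (n : ℝ) ^ 4 - 24 * (n : ℝ) ^ 3 * m + 22 * (n : ℝ) ^ 2 * (m : ℝ) ^ 2
          - 8 * (n : ℝ) * (m : ℝ) ^ 3 + (m : ℝ) ^ 4 - 24 * (n : ℝ) ^ 3
          + 30 * (n : ℝ) ^ 2 * m - 14 * (n : ℝ) * (m : ℝ) ^ 2 + 2 * (m : ℝ) ^ 3
          + 8 * (n : ℝ) ^ 2 - 10 * (n : ℝ) * m + 2 * (m : ℝ) ^ 2 - 4 * (n : ℝ) + m) *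
        Zl n (m + 1)
      - (2 * (n : ℝ) - m - 1) ^ 3 * (4 * (n : ℝ) - m) * ((m : ℝ) + 2) * Zl n (m + 2) = 0 := by
  have h := recurrenceOp_tsum_deriv_R hmn
  rw [recurrenceOp] at h
  rw [Zl_eq_tsum (m := m) (by omega), Zl_eq_tsum (m := m + 1) (by omega),
    Zl_eq_tsum (m := m + 2) hmn]
  linear_combination -(1 / 3) * h
end
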